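/- For ε > 0, the function M_ε(λ) = λ²/|λ² − (1+iε)|² on ℝ is integrable, and its Fourier transform is given explicitly by M̂_ε(τ) = (π/(2ε)) ( √(1+iε) e^{i|τ|√(1+iε)} + √(1−iε) e^{−i|τ|√(1−iε)} ), where the square roots are taken with positive imaginary part appropriately so that the exponentials decay. -/

import Mathlib

open MeasureTheory Real Complex

/-- The multiplier `M_ε(λ) = λ²/|λ² − (1+iε)|² = λ²/((λ²−1)² + ε²)` on ℝ. -/
noncomputable def Meps (ε : ℝ) (lam : ℝ) : ℝ :=
  lam ^ 2 / ((lam ^ 2 - 1) ^ 2 + ε ^ 2)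

open scoped FourierTransform

/-- The Fourier transform of `t ↦ exp (c |t|)` for `Re c < 0`, together with integrability. -/
lemma integral_cexp_mul_abs {c : ℂ} (hc : c.re < 0) (x : ℝ) :
    Integrable (fun t : ℝ ↦ Complex.exp (c * |t|) * Complex.exp (-Complex.I * x * t)) ∧
      ∫ t : ℝ, Complex.exp (c * |t|) * Complex.exp (-Complex.I * x * t)
        = -2 * c / (c ^ 2 + x ^ 2) := by
  set f : ℝ → ℂ := fun t ↦ Complex.exp (c * |t|) * Complex.exp (-Complex.I * x * t)
  have hp : (c - Complex.I * x).re < 0 := by simpa using hc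
  have hm : 0 < (-c - Complex.I * x).re := by simpa using hc
  have ep : Set.EqOn f (fun t : ℝ ↦ Complex.exp ((c - Complex.I * x) * t)) (Set.Ioi 0) := by
    intro t ht
    simp only [f, ← Complex.exp_add, abs_of_pos (Set.mem_Ioi.mp ht)]
    ring_nf
  have em : Set.EqOn f (fun t : ℝ ↦ Complex.exp ((-c - Complex.I * x) * t)) (Set.Iic 0) := by
    intro t ht
    simp only [f, ← Complex.exp_add, abs_of_nonpos (Set.mem_Iic.mp ht)]
    push_cast
    ring_nf
  have ip : IntegrableOn f (Set.Ioi 0) :=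
    (integrableOn_congr_fun ep measurableSet_Ioi).2 (integrableOn_exp_mul_complex_Ioi hp 0)
  have im : IntegrableOn f (Set.Iic 0) :=
    (integrableOn_congr_fun em measurableSet_Iic).2 (integrableOn_exp_mul_complex_Iic hm 0)
  refine ⟨by simpa [Set.Iic_union_Ioi] using im.union ip, ?_⟩
  rw [← intervalIntegral.integral_Iic_add_Ioi im ip, setIntegral_congr_fun measurableSet_Ioi ep,
    setIntegral_congr_fun measurableSet_Iic em, integral_exp_mul_complex_Ioi hp,
    integral_exp_mul_complex_Iic hm]
  have h1 : c - Complex.I * x ≠ 0 := fun h ↦ by simp [h] at hp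
  have h2 : -c - Complex.I * x ≠ 0 := fun h ↦ by simp [h] at hm
  have h3 : c ^ 2 + (x : ℂ) ^ 2 = -((c - Complex.I * x) * (-c - Complex.I * x)) := by
    linear_combination (x : ℂ) ^ 2 * Complex.I_sq
  rw [h3]
  simp only [Complex.ofReal_zero, mul_zero, Complex.exp_zero]
  field_simp
  ring

lemma Meps_integrable {ε : ℝ} (hε : 0 < ε) : Integrable (Meps ε) := by
  have hpos (x : ℝ) : 0 < (x ^ 2 - 1) ^ 2 + ε ^ 2 := by positivity
  refine (integrable_inv_one_add_sq.const_mul (3 + 4 / ε ^ 2)).mono' ?_ (.of_forall fun x ↦ ?_)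
  · refine Continuous.aestronglyMeasurable ?_
    unfold Meps
    exact Continuous.div (by fun_prop) (by fun_prop) fun x ↦ (hpos x).ne'
  · have h0 : 0 ≤ Meps ε x := div_nonneg (sq_nonneg x) (hpos x).le
    rw [Real.norm_of_nonneg h0, Meps, ← div_eq_mul_inv, div_le_div_iff₀ (hpos x) (by positivity)]
    have h : (3 + 4 / ε ^ 2) * ((x ^ 2 - 1) ^ 2 + ε ^ 2)
        = 3 * (x ^ 2 - 1) ^ 2 + 3 * ε ^ 2 + 4 + 4 / ε ^ 2 * (x ^ 2 - 1) ^ 2 := by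
      field_simp
      ring
    have h' : 0 ≤ 4 / ε ^ 2 * (x ^ 2 - 1) ^ 2 := by positivity
    nlinarith [sq_nonneg (x ^ 2 - 1), sq_nonneg (x ^ 2 - 2), sq_nonneg ε]

/-- Fourier transform of `Meps ε`, for any square roots `a` of `1 + iε` in the upper half-plane
and `b` of `1 - iε` in the lower half-plane. -/
lemma integral_Meps_mul_cexp {ε : ℝ} (hε : 0 < ε) {a b : ℂ} (ha : 0 < a.im) (hb : b.im < 0)
    (ha2 : a ^ 2 = 1 + ε * Complex.I) (hb2 : b ^ 2 = 1 - ε * Complex.I) (τ : ℝ) :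
    ∫ x : ℝ, (Meps ε x : ℂ) * Complex.exp (-Complex.I * x * τ)
      = (π / (2 * ε) : ℝ) * (a * Complex.exp (Complex.I * |τ| * a)
          + b * Complex.exp (-Complex.I * |τ| * b)) := by
  have hεc : (ε : ℂ) ≠ 0 := by exact_mod_cast hε.ne'
  have hca : (Complex.I * a).re < 0 := by simpa using ha
  have hcb : (-Complex.I * b).re < 0 := by simpa using hb
  set g : ℝ → ℂ := fun t ↦ a * Complex.exp (Complex.I * a * |t|)
    + b * Complex.exp (-Complex.I * b * |t|) with hg
  have gcont : Continuous g := by fun_prop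
  have gint : Integrable g := by
    have h1 := (integral_cexp_mul_abs hca 0).1
    have h2 := (integral_cexp_mul_abs hcb 0).1
    simp only [Complex.ofReal_zero, mul_zero, zero_mul, Complex.exp_zero, mul_one] at h1 h2
    exact (h1.const_mul a).add (h2.const_mul b)
  have hF : 𝓕 g = fun v : ℝ ↦ ((4 * ε : ℝ) : ℂ) * (Meps ε (2 * π * v) : ℂ) := by
    ext v
    obtain ⟨i1, e1⟩ := integral_cexp_mul_abs hca (2 * π * v)
    obtain ⟨i2, e2⟩ := integral_cexp_mul_abs hcb (2 * π * v)
    have hsplit : 𝓕 g v = a * (-2 * (Complex.I * a) / ((Complex.I * a) ^ 2 + (2 * π * v : ℝ) ^ 2))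
        + b * (-2 * (-Complex.I * b) / ((-Complex.I * b) ^ 2 + (2 * π * v : ℝ) ^ 2)) := by
      rw [← e1, ← e2, ← integral_const_mul, ← integral_const_mul,
        ← integral_add (i1.const_mul a) (i2.const_mul b), Real.fourier_real_eq_integral_exp_smul]
      refine integral_congr_ae (.of_forall fun t ↦ ?_)
      have h : ((-2 * π * t * v : ℝ) : ℂ) * Complex.I
          = -Complex.I * (2 * π * v : ℝ) * t := by push_cast; ring
      simp only [hg, h, smul_eq_mul]
      ring
    rw [hsplit]
    generalize 2 * π * v = x
    have hA : (x : ℂ) ^ 2 - 1 - ε * Complex.I ≠ 0 := fun h ↦ by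
      have := congrArg Complex.im h
      simp [← Complex.ofReal_pow, hε.ne'] at this
    have hB : (x : ℂ) ^ 2 - 1 + ε * Complex.I ≠ 0 := fun h ↦ by
      have := congrArg Complex.im h
      simp [← Complex.ofReal_pow, hε.ne'] at this
    have eA : (Complex.I * a) ^ 2 + (x : ℂ) ^ 2 = (x : ℂ) ^ 2 - 1 - ε * Complex.I := by
      rw [mul_pow, ha2, Complex.I_sq]; ring
    have eB : (-Complex.I * b) ^ 2 + (x : ℂ) ^ 2 = (x : ℂ) ^ 2 - 1 + ε * Complex.I := by
      rw [mul_pow, hb2, neg_sq, Complex.I_sq]; ring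
    have eM : ((x : ℂ) ^ 2 - 1) ^ 2 + (ε : ℂ) ^ 2
        = ((x : ℂ) ^ 2 - 1 - ε * Complex.I) * ((x : ℂ) ^ 2 - 1 + ε * Complex.I) := by
      linear_combination (ε : ℂ) ^ 2 * Complex.I_sq
    have nA : a * (-2 * (Complex.I * a)) = -2 * Complex.I * (1 + ε * Complex.I) := by
      rw [← ha2]; ring
    have nB : b * (-2 * (-Complex.I * b)) = 2 * Complex.I * (1 - ε * Complex.I) := by
      rw [← hb2]; ring
    rw [eA, eB, ← mul_div_assoc, ← mul_div_assoc, nA, nB, Meps]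
    push_cast
    rw [eM, div_add_div _ _ hA hB, ← mul_div_assoc]
    congr 1
    linear_combination (-4 * (x : ℂ) ^ 2 * ε) * Complex.I_sq
  have hFint : Integrable (𝓕 g) := by
    rw [hF]
    exact (((Meps_integrable hε).comp_mul_left' (by positivity : 2 * π ≠ 0)).ofReal).const_mul _
  have hinv := congrFun (gcont.fourierInv_fourier_eq gint hFint) (-τ)
  have hscale := Measure.integral_comp_mul_left
    (fun x : ℝ ↦ (Meps ε x : ℂ) * Complex.exp (-Complex.I * x * τ)) (2 * π)
  have hL : 𝓕⁻ (𝓕 g) (-τ) = ((4 * ε : ℝ) : ℂ) *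
      ∫ v : ℝ, (Meps ε (2 * π * v) : ℂ) * Complex.exp (-Complex.I * (2 * π * v : ℝ) * τ) := by
    rw [Real.fourierInv_eq', hF, ← integral_const_mul]
    refine integral_congr_ae (.of_forall fun v ↦ ?_)
    have h : ((2 * π * inner ℝ v (-τ) : ℝ) : ℂ) * Complex.I
        = -Complex.I * (2 * π * v : ℝ) * τ := by
      simp
      ring
    simp only [h, smul_eq_mul]
    ring
  rw [hL, hscale, abs_of_pos (by positivity), Complex.real_smul] at hinv
  have hπ : (π : ℂ) ≠ 0 := by exact_mod_cast Real.pi_ne_zero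
  have hgτ : g (-τ) = a * Complex.exp (Complex.I * |τ| * a)
      + b * Complex.exp (-Complex.I * |τ| * b) := by
    simp only [hg, abs_neg]
    ring_nf
  rw [← hgτ, ← hinv]
  generalize ∫ y : ℝ, (Meps ε y : ℂ) * Complex.exp (-Complex.I * y * τ) = J
  push_cast
  field_simp
  norm_num

theorem Meps_integrable_and_fourier (ε : ℝ) (hε : 0 < ε) :
    Integrable (Meps ε) ∧
      ∀ τ : ℝ,
        (∫ lam : ℝ, (Meps ε lam : ℂ) * Complex.exp (-Complex.I * lam * τ))
          = (π / (2 * ε) : ℝ) *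
              (((1 + ε * Complex.I) ^ ((1:ℂ)/2)) *
                  Complex.exp (Complex.I * |τ| * ((1 + ε * Complex.I) ^ ((1:ℂ)/2)))
                + ((1 - ε * Complex.I) ^ ((1:ℂ)/2)) *
                  Complex.exp (-Complex.I * |τ| * ((1 - ε * Complex.I) ^ ((1:ℂ)/2)))) := by
  have hsq (z : ℂ) : (z ^ ((1 : ℂ) / 2)) ^ 2 = z := by
    simp
  have hre (z : ℂ) : 0 ≤ (z ^ ((1 : ℂ) / 2)).re := by
    rw [one_div, Complex.cpow_inv_two_re]
    positivity
  have him (z : ℂ) : 2 * (z ^ ((1 : ℂ) / 2)).re * (z ^ ((1 : ℂ) / 2)).im = z.im := by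
    conv_rhs => rw [← hsq z, sq, Complex.mul_im]
    ring
  refine ⟨Meps_integrable hε, integral_Meps_mul_cexp hε ?_ ?_ (hsq _) (hsq _)⟩
  · have h := him (1 + ε * Complex.I)
    simp only [Complex.add_im, Complex.one_im, Complex.im_ofReal_mul,
      Complex.I_im] at h
    by_contra! h'
    nlinarith [mul_nonneg (hre (1 + ε * Complex.I)) (neg_nonneg.2 h')]
  · have h := him (1 - ε * Complex.I)
    simp only [Complex.sub_im, Complex.one_im, Complex.im_ofReal_mul,
      Complex.I_im] at h
    by_contra! h'
    nlinarith [mul_nonneg (hre (1 - ε * Complex.I)) h']
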